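/- arXiv:1708.01700 — 2 statements merged into one kernel-verified Lean document; each statement's English description precedes it below -/
import Mathlib

section
/- For every integer n ≥ 3, if n is even there exists a proper colouring of the Mycielskian μ(C_n) of the cycle C_n using the three colours 1, 2, 3 whose colouring mean equals (7n+4)/(4n+2) and whose colouring variance equals (11n²+6n)/(4n+2)²; if n is odd there exists a proper colouring of μ(C_n) using the four colours 1, 2, 3, 4 whose colouring mean equals (7n+7)/(4n+2) and whose colouring variance equals (44n³+182n²+100n+10)/(4n+2)³. -/
open Finset

/-- The Mycielskian of a graph `G` on vertex set `V`: vertices are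
`V ⊕ V ⊕ Unit` where `Sum.inl a` is the original vertex `v_a`,
`Sum.inr (Sum.inl a)` is the shadow vertex `u_a`, and `Sum.inr (Sum.inr ())`
is the apex vertex `u`. -/
def mycielskian {V : Type*} (G : SimpleGraph V) : SimpleGraph (V ⊕ V ⊕ Unit) :=
  SimpleGraph.fromRel (fun x y =>
    match x, y with
    | Sum.inl a, Sum.inl b => G.Adj a b
    | Sum.inl a, Sum.inr (Sum.inl b) => G.Adj a b
    | Sum.inr (Sum.inl _), Sum.inr (Sum.inr _) => True
    | _, _ => False)

/-- `colClass c i` is the number of vertices receiving colour `i`. -/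
def colClass {V : Type*} [Fintype V] (c : V → ℕ) (i : ℕ) : ℕ :=
  (Finset.univ.filter (fun v => c v = i)).card

/-- The colouring mean of a colouring `c` using colours `1, …, k`. -/
def colMean {V : Type*} [Fintype V] (c : V → ℕ) (k : ℕ) : ℚ :=
  (∑ i ∈ Finset.Icc 1 k, (i : ℚ) * (colClass c i)) / (Fintype.card V : ℚ)

/-- The colouring variance of a colouring `c` using colours `1, …, k`. -/
def colVar {V : Type*} [Fintype V] (c : V → ℕ) (k : ℕ) : ℚ :=
  (∑ i ∈ Finset.Icc 1 k, (i : ℚ) ^ 2 * (colClass c i)) / (Fintype.card V : ℚ)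
    - (colMean c k) ^ 2

/-- The path graph `P_n` on `Fin n`. -/
def pathG (n : ℕ) : SimpleGraph (Fin n) :=
  SimpleGraph.fromRel (fun i j => (i : ℕ) + 1 = (j : ℕ))

/-- The cycle graph $C_n$ on `Fin n` (intended for `n ≥ 3`). -/
def cycleG (n : ℕ) : SimpleGraph (Fin n) :=
  SimpleGraph.fromRel (fun i j => ((i : ℕ) + 1) % n = (j : ℕ))

/-- The colouring of `V ⊕ V ⊕ Unit` given by `g` on original vertices, `h` on shadow vertices
and `a` on the apex. -/
def mycielskianColouring {V : Type*} (g h : V → ℕ) (a : ℕ) : V ⊕ V ⊕ Unit → ℕ :=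
  Sum.elim g (Sum.elim h fun _ => a)

theorem mycielskianColouring_proper {V : Type*} {G : SimpleGraph V} {g h : V → ℕ} {a : ℕ}
    (hg : ∀ i j, G.Adj i j → g i ≠ g j) (hgh : ∀ i j, G.Adj i j → g i ≠ h j)
    (ha : ∀ i, h i ≠ a) (x y : V ⊕ V ⊕ Unit) (hxy : (mycielskian G).Adj x y) :
    mycielskianColouring g h a x ≠ mycielskianColouring g h a y := by
  rw [mycielskian, SimpleGraph.fromRel_adj] at hxy
  obtain ⟨-, hxy⟩ := hxy
  rcases x with i | i | _ <;> rcases y with j | j | _ <;>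
    simp only [or_false, false_or, or_self] at hxy <;>
    simp only [mycielskianColouring, Sum.elim_inl, Sum.elim_inr]
  · exact hxy.elim (hg i j) fun h' => (hg j i h').symm
  · exact hgh i j hxy
  · exact (hgh j i hxy).symm
  · exact ha i
  · exact (ha j).symm

theorem sum_mul_colClass {V : Type*} [Fintype V] {c : V → ℕ} {k : ℕ}
    (hc : ∀ v, c v ∈ Finset.Icc 1 k) (f : ℕ → ℚ) :
    ∑ i ∈ Finset.Icc 1 k, f i * (colClass c i : ℚ) = ∑ v, f (c v) := by
  rw [← Finset.sum_fiberwise_of_maps_to (fun v _ => hc v)]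
  refine Finset.sum_congr rfl fun i _ => ?_
  rw [Finset.sum_congr rfl fun v hv => congrArg f (Finset.mem_filter.mp hv).2,
    Finset.sum_const, nsmul_eq_mul, mul_comm, colClass]

theorem colMean_eq {V : Type*} [Fintype V] {c : V → ℕ} {k : ℕ}
    (hc : ∀ v, c v ∈ Finset.Icc 1 k) :
    colMean c k = (∑ v, (c v : ℚ)) / Fintype.card V := by
  rw [colMean, sum_mul_colClass hc fun i => (i : ℚ)]

theorem colVar_eq {V : Type*} [Fintype V] {c : V → ℕ} {k : ℕ}
    (hc : ∀ v, c v ∈ Finset.Icc 1 k) :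
    colVar c k = (∑ v, (c v : ℚ) ^ 2) / Fintype.card V
      - ((∑ v, (c v : ℚ)) / Fintype.card V) ^ 2 := by
  rw [colVar, colMean_eq hc, sum_mul_colClass hc fun i => (i : ℚ) ^ 2]

theorem sum_mycielskianColouring {n : ℕ} (g h : ℕ → ℕ) (a : ℕ) (f : ℕ → ℚ) :
    ∑ v, f (mycielskianColouring (fun i : Fin n => g i) (fun i : Fin n => h i) a v) =
      ∑ i ∈ Finset.range n, f (g i) + (∑ i ∈ Finset.range n, f (h i) + f a) := by
  simp [mycielskianColouring, Fintype.sum_sum_type,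
    ← Fin.sum_univ_eq_sum_range (fun i => f (g i)),
    ← Fin.sum_univ_eq_sum_range (fun i => f (h i))]

theorem sum_range_two_mul_mod_two (f : ℕ → ℚ) (m : ℕ) :
    ∑ i ∈ Finset.range (2 * m), f (i % 2) = m * (f 0 + f 1) := by
  induction m with
  | zero => simp
  | succ m ih =>
    rw [show 2 * (m + 1) = 2 * m + 1 + 1 by ring, Finset.sum_range_succ, Finset.sum_range_succ, ih,
      show 2 * m % 2 = 0 by omega, show (2 * m + 1) % 2 = 1 by omega]
    push_cast
    ring

theorem cycleG_adj_cases {n : ℕ} {i j : Fin n} (h : (cycleG n).Adj i j) :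
    i ≠ j ∧ ((i : ℕ) + 1 = j ∨ (j : ℕ) + 1 = i ∨ ((i : ℕ) + 1 = n ∧ (j : ℕ) = 0) ∨
      ((j : ℕ) + 1 = n ∧ (i : ℕ) = 0)) := by
  rw [cycleG, SimpleGraph.fromRel_adj] at h
  refine ⟨h.1, ?_⟩
  have mod_cases (k : Fin n) : ((k : ℕ) + 1) % n = k + 1 ∨
      ((k : ℕ) + 1 = n ∧ ((k : ℕ) + 1) % n = 0) := by
    rcases Nat.lt_or_eq_of_le (Nat.succ_le_of_lt k.isLt) with hk | hk
    · exact Or.inl (Nat.mod_eq_of_lt hk)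
    · exact Or.inr ⟨hk, by rw [show (k : ℕ) + 1 = n from hk, Nat.mod_self]⟩
  have hi := mod_cases i
  have hj := mod_cases j
  omega

theorem exists_colouring_mycielskian_even_cycle (m : ℕ) :
    ∃ c : (Fin (2 * m) ⊕ Fin (2 * m) ⊕ Unit) → ℕ,
      (∀ v, c v ∈ Finset.Icc 1 3) ∧
      (∀ x y, (mycielskian (cycleG (2 * m))).Adj x y → c x ≠ c y) ∧
      (∑ v, (c v : ℚ)) = 7 * m + 2 ∧ (∑ v, (c v : ℚ) ^ 2) = 15 * m + 4 := by
  refine ⟨mycielskianColouring (fun i => 1 + (i : ℕ) % 2) (fun i => 1 + 2 * ((i : ℕ) % 2)) 2,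
    ?_, mycielskianColouring_proper ?_ ?_ ?_, ?_, ?_⟩
  · rintro (i | i | _) <;> simp [mycielskianColouring] <;> omega
  · intro i j hij
    have := cycleG_adj_cases hij
    omega
  · intro i j hij
    have := cycleG_adj_cases hij
    omega
  · intro i
    omega
  · rw [sum_mycielskianColouring (fun i => 1 + i % 2) (fun i => 1 + 2 * (i % 2)) 2 (fun i => (i : ℚ)),
      sum_range_two_mul_mod_two (fun i => ((1 + i : ℕ) : ℚ)),
      sum_range_two_mul_mod_two (fun i => ((1 + 2 * i : ℕ) : ℚ))]
    norm_num
    ring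
  · rw [sum_mycielskianColouring (fun i => 1 + i % 2) (fun i => 1 + 2 * (i % 2)) 2
        (fun i => (i : ℚ) ^ 2),
      sum_range_two_mul_mod_two (fun i => ((1 + i : ℕ) : ℚ) ^ 2),
      sum_range_two_mul_mod_two (fun i => ((1 + 2 * i : ℕ) : ℚ) ^ 2)]
    norm_num
    ring

theorem sum_range_ite_last (f : ℕ → ℚ) (m : ℕ) :
    ∑ i ∈ Finset.range (2 * m + 1), f (if i = 2 * m then 4 else 2 + i % 2) =
      m * (f 2 + f 3) + f 4 := by
  rw [Finset.sum_range_succ, if_pos rfl, ← sum_range_two_mul_mod_two (fun i => f (2 + i))]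
  congr 1
  refine Finset.sum_congr rfl fun i hi => ?_
  rw [if_neg (Finset.mem_range.mp hi).ne]

theorem exists_colouring_mycielskian_odd_cycle (m : ℕ) :
    ∃ c : (Fin (2 * m + 1) ⊕ Fin (2 * m + 1) ⊕ Unit) → ℕ,
      (∀ v, c v ∈ Finset.Icc 1 4) ∧
      (∀ x y, (mycielskian (cycleG (2 * m + 1))).Adj x y → c x ≠ c y) ∧
      (∑ v, (c v : ℚ)) = 7 * m + 7 ∧ (∑ v, (c v : ℚ) ^ 2) = 15 * m + 21 := by
  refine ⟨mycielskianColouring (fun i => if (i : ℕ) = 2 * m then 4 else 2 + (i : ℕ) % 2)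
    (fun _ => 1) 2, ?_, mycielskianColouring_proper ?_ ?_ ?_, ?_, ?_⟩
  · rintro (i | i | _) <;> simp [mycielskianColouring]
    split_ifs <;> omega
  · intro i j hij
    have := cycleG_adj_cases hij
    split_ifs <;> omega
  · intro i j _
    split_ifs <;> omega
  · intro i
    omega
  · rw [sum_mycielskianColouring (fun i => if i = 2 * m then 4 else 2 + i % 2) (fun _ => 1) 2
        (fun i => (i : ℚ)), sum_range_ite_last (fun i => (i : ℚ))]
    simp
    ring
  · rw [sum_mycielskianColouring (fun i => if i = 2 * m then 4 else 2 + i % 2) (fun _ => 1) 2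
        (fun i => (i : ℚ) ^ 2), sum_range_ite_last (fun i => (i : ℚ) ^ 2)]
    simp
    ring

/-- The $χ$-chromatic mean and variance of the Mycielskian of the cycle $C_n$. -/
theorem chi_chromatic_parameters_mycielskian_cycle (n : ℕ) (hn : 3 ≤ n) :
    (Even n →
      ∃ c : (Fin n ⊕ Fin n ⊕ Unit) → ℕ,
        (∀ v, c v ∈ Finset.Icc 1 3) ∧
        (∀ x y, (mycielskian (cycleG n)).Adj x y → c x ≠ c y) ∧
        colMean c 3 = (7 * (n : ℚ) + 4) / (4 * (n : ℚ) + 2) ∧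
        colVar c 3 = (11 * (n : ℚ) ^ 2 + 6 * (n : ℚ)) / (4 * (n : ℚ) + 2) ^ 2) ∧
    (Odd n →
      ∃ c : (Fin n ⊕ Fin n ⊕ Unit) → ℕ,
        (∀ v, c v ∈ Finset.Icc 1 4) ∧
        (∀ x y, (mycielskian (cycleG n)).Adj x y → c x ≠ c y) ∧
        colMean c 4 = (7 * (n : ℚ) + 7) / (4 * (n : ℚ) + 2) ∧
        colVar c 4 = (44 * (n : ℚ) ^ 3 + 182 * (n : ℚ) ^ 2 + 100 * (n : ℚ) + 10)
          / (4 * (n : ℚ) + 2) ^ 3) := by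
  have card_eq (k : ℕ) : (Fintype.card (Fin k ⊕ Fin k ⊕ Unit) : ℚ) = 2 * k + 1 := by
    simp
    ring
  constructor
  · intro hev
    obtain ⟨m, rfl⟩ := hev.two_dvd
    obtain ⟨c, hc, hproper, hsum, hsq⟩ := exists_colouring_mycielskian_even_cycle m
    refine ⟨c, hc, hproper, ?_, ?_⟩
    · rw [colMean_eq hc, hsum, card_eq, div_eq_div_iff (by positivity) (by positivity)]
      push_cast
      ring
    · rw [colVar_eq hc, hsum, hsq, card_eq, div_pow, div_sub_div _ _ (by positivity) (by positivity),
        div_eq_div_iff (by positivity) (by positivity)]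
      push_cast
      ring
  · rintro ⟨m, rfl⟩
    obtain ⟨c, hc, hproper, hsum, hsq⟩ := exists_colouring_mycielskian_odd_cycle m
    refine ⟨c, hc, hproper, ?_, ?_⟩
    · rw [colMean_eq hc, hsum, card_eq, div_eq_div_iff (by positivity) (by positivity)]
      push_cast
      ring
    · rw [colVar_eq hc, hsum, hsq, card_eq, div_pow, div_sub_div _ _ (by positivity) (by positivity),
        div_eq_div_iff (by positivity) (by positivity)]
      push_cast
      ring
end

section
/- For every integer n ≥ 2, there exists a proper colouring of the Mycielskian μ(P_n) of the path P_n using the three colours 1, 2, 3 whose colouring mean equals (9n+5)/(4n+2) when n is odd and (9n+4)/(4n+2) when n is even, and whose colouring variance equals (44n³+22n²−12n−6)/(4n+2)³ when n is odd and (11n²+6n)/(4n+2)² when n is even. -/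
open Finset

/-- The colouring of the Mycielskian of a path giving the original vertices the colours
`2, 1, 2, 1, …` in order, every shadow vertex the colour `3`, and the apex the colour `2`. -/
def mycielskianPathColouring (n : ℕ) : Fin n ⊕ Fin n ⊕ Unit → ℕ
  | Sum.inl a => 2 - (a : ℕ) % 2
  | Sum.inr (Sum.inl _) => 3
  | Sum.inr (Sum.inr _) => 2

theorem mycielskianPathColouring_mem_Icc (n : ℕ) (v : Fin n ⊕ Fin n ⊕ Unit) :
    mycielskianPathColouring n v ∈ Finset.Icc 1 3 := by
  rcases v with a | a | a <;> simp only [mycielskianPathColouring, Finset.mem_Icc] <;> omega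

theorem mycielskianPathColouring_proper (n : ℕ) (x y : Fin n ⊕ Fin n ⊕ Unit)
    (h : (mycielskian (pathG n)).Adj x y) :
    mycielskianPathColouring n x ≠ mycielskianPathColouring n y := by
  rcases x with a | a | a <;> rcases y with b | b | b <;>
    simp [mycielskian, pathG, SimpleGraph.fromRel_adj] at h <;>
    simp only [mycielskianPathColouring] <;> omega

/-- The size of a colour class, split over original vertices, shadow vertices and apex. -/
theorem colClass_mycielskianPathColouring (n i : ℕ) :
    colClass (mycielskianPathColouring n) i =
      (∑ a ∈ Finset.range n, if 2 - a % 2 = i then 1 else 0) +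
        ((if 3 = i then n else 0) + if 2 = i then 1 else 0) := by
  rw [← Fin.sum_univ_eq_sum_range (fun a => if 2 - a % 2 = i then 1 else 0)]
  rw [colClass, Finset.card_filter, Fintype.sum_sum_type, Fintype.sum_sum_type]
  change _ + ((∑ _ : Fin n, if 3 = i then 1 else 0) + ∑ _ : Unit, if 2 = i then 1 else 0) = _
  rw [Fin.sum_const, Fintype.sum_unique (ι := Unit), smul_ite, smul_zero, smul_eq_mul, mul_one]
  rfl

theorem colClass_mycielskianPathColouring_one (n : ℕ) :
    colClass (mycielskianPathColouring n) 1 = n / 2 := by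
  rw [colClass_mycielskianPathColouring]
  induction n with
  | zero => simp
  | succ k ih =>
    rw [Finset.sum_range_succ]
    split_ifs at ih ⊢ <;> omega

theorem colClass_mycielskianPathColouring_two (n : ℕ) :
    colClass (mycielskianPathColouring n) 2 = (n + 1) / 2 + 1 := by
  rw [colClass_mycielskianPathColouring]
  induction n with
  | zero => simp
  | succ k ih =>
    rw [Finset.sum_range_succ]
    split_ifs at ih ⊢ <;> omega

theorem colClass_mycielskianPathColouring_three (n : ℕ) :
    colClass (mycielskianPathColouring n) 3 = n := by
  rw [colClass_mycielskianPathColouring, Finset.sum_eq_zero]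
  · simp
  · intro a _
    rw [if_neg (by omega)]

theorem colMean_mycielskianPathColouring (n : ℕ) :
    colMean (mycielskianPathColouring n) 3 =
      (((n / 2 : ℕ) : ℚ) + 2 * (((n + 1) / 2 : ℕ) + 1) + 3 * n) / (2 * n + 1) := by
  simp only [colMean, Finset.sum_Icc_succ_top (Nat.le_add_left 1 _), Finset.Icc_self,
    Finset.sum_singleton, Nat.reduceAdd, Fintype.card_sum, Fintype.card_fin, Fintype.card_unit,
    colClass_mycielskianPathColouring_one, colClass_mycielskianPathColouring_two,
    colClass_mycielskianPathColouring_three]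
  push_cast
  congr 1 <;> ring

theorem colVar_mycielskianPathColouring (n : ℕ) :
    colVar (mycielskianPathColouring n) 3 =
      (((n / 2 : ℕ) : ℚ) + 4 * (((n + 1) / 2 : ℕ) + 1) + 9 * n) / (2 * n + 1) -
        colMean (mycielskianPathColouring n) 3 ^ 2 := by
  simp only [colVar, Finset.sum_Icc_succ_top (Nat.le_add_left 1 _), Finset.Icc_self,
    Finset.sum_singleton, Nat.reduceAdd, Fintype.card_sum, Fintype.card_fin, Fintype.card_unit,
    colClass_mycielskianPathColouring_one, colClass_mycielskianPathColouring_two,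
    colClass_mycielskianPathColouring_three]
  push_cast
  congr 2 <;> ring

/-- The $χ^+$-chromatic mean and variance of the Mycielskian of the path $P_n$. -/
theorem chi_plus_chromatic_parameters_mycielskian_path (n : ℕ) (hn : 2 ≤ n) :
    ∃ c : (Fin n ⊕ Fin n ⊕ Unit) → ℕ,
      (∀ v, c v ∈ Finset.Icc 1 3) ∧
      (∀ x y, (mycielskian (pathG n)).Adj x y → c x ≠ c y) ∧
      (Odd n →
        colMean c 3 = (9 * (n : ℚ) + 5) / (4 * (n : ℚ) + 2) ∧
        colVar c 3 = (44 * (n : ℚ) ^ 3 + 22 * (n : ℚ) ^ 2 - 12 * (n : ℚ) - 6)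
          / (4 * (n : ℚ) + 2) ^ 3) ∧
      (Even n →
        colMean c 3 = (9 * (n : ℚ) + 4) / (4 * (n : ℚ) + 2) ∧
        colVar c 3 = (11 * (n : ℚ) ^ 2 + 6 * (n : ℚ)) / (4 * (n : ℚ) + 2) ^ 2) := by
  refine ⟨mycielskianPathColouring n, mycielskianPathColouring_mem_Icc n,
    mycielskianPathColouring_proper n, ?_, ?_⟩
  · rintro ⟨m, rfl⟩
    rw [colVar_mycielskianPathColouring, colMean_mycielskianPathColouring,
      show (2 * m + 1) / 2 = m by omega, show (2 * m + 1 + 1) / 2 = m + 1 by omega]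
    push_cast
    have h₁ : (2 * (2 * (m : ℚ) + 1) + 1) ≠ 0 := by positivity
    have h₂ : (4 * (2 * (m : ℚ) + 1) + 2) ≠ 0 := by positivity
    constructor
    · rw [div_eq_div_iff h₁ h₂]
      ring
    · rw [div_pow, div_sub_div _ _ h₁ (pow_ne_zero 2 h₁),
        div_eq_div_iff (mul_ne_zero h₁ (pow_ne_zero 2 h₁)) (pow_ne_zero 3 h₂)]
      ring
  · rintro ⟨m, rfl⟩
    rw [colVar_mycielskianPathColouring, colMean_mycielskianPathColouring,
      show (m + m) / 2 = m by omega, show (m + m + 1) / 2 = m by omega]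
    push_cast
    have h₁ : (2 * ((m : ℚ) + m) + 1) ≠ 0 := by positivity
    have h₂ : (4 * ((m : ℚ) + m) + 2) ≠ 0 := by positivity
    constructor
    · rw [div_eq_div_iff h₁ h₂]
      ring
    · rw [div_pow, div_sub_div _ _ h₁ (pow_ne_zero 2 h₁),
        div_eq_div_iff (mul_ne_zero h₁ (pow_ne_zero 2 h₁)) (pow_ne_zero 2 h₂)]
      ring
end
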